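/- There exists a homeomorphism σ : Ω → Ω with σ∘σ∘σ = id_Ω such that for every good set S other than A ∪ B and B ∪ C, σ maps convexHull(S) onto convexHull(τ(S)) and coincides on convexHull(S) with the unique affine map sending each v ∈ S to τ(v), where τ : X → X is the bijection with τ(A_j) = B_j, τ(B_j) = C_j, τ(C_j) = A_j for all j. In particular σ maps the relative (intrinsic) boundary of Δ₀ onto that of Δ₁, that of Δ₁ onto that of Δ₂, and that of Δ₂ onto that of Δ₀, acting affinely on each of these boundaries. (Block Lemma: Ω is a modular block whose outer terminal is the boundary of Δ₀.) -/

import Mathlib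

noncomputable section

/-- The ambient space `ℝ^{2k}`, written as pairs `(x, y)` with `x, y ∈ ℝ^k`. -/
abbrev V (k : ℕ) := (Fin k ⊕ Fin k) → ℝ

/-- `A_j = (e_j, 0)`. -/
def vA (k : ℕ) (j : Fin k) : V k
  | .inl i => if i = j then 1 else 0
  | .inr _ => 0

/-- `B_j = (1/(2n)) · (2·𝟙 − e_j, 2·𝟙 − e_j)` with `n = 2k − 1`. -/
def vB (k : ℕ) (j : Fin k) : V k
  | .inl i => (2 - if i = j then 1 else 0) / (2 * (2 * (k : ℝ) - 1))
  | .inr i => (2 - if i = j then 1 else 0) / (2 * (2 * (k : ℝ) - 1))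

/-- `C_j = (0, e_j)`. -/
def vC (k : ℕ) (j : Fin k) : V k
  | .inl _ => 0
  | .inr i => if i = j then 1 else 0

def setA (k : ℕ) : Set (V k) := Set.range (vA k)
def setB (k : ℕ) : Set (V k) := Set.range (vB k)
def setC (k : ℕ) : Set (V k) := Set.range (vC k)
def setX (k : ℕ) : Set (V k) := setA k ∪ setB k ∪ setC k

/-- A subset `S ⊆ X` is good if it has exactly `2k` elements, contains no full
triple `{A_j, B_j, C_j}`, and `S ≠ A ∪ C`. -/
def IsGood (k : ℕ) (S : Set (V k)) : Prop :=
  S ⊆ setX k ∧ S.ncard = 2 * k ∧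
  (∀ j : Fin k, ¬ (({vA k j, vB k j, vC k j} : Set (V k)) ⊆ S)) ∧
  S ≠ setA k ∪ setC k

def Delta0 (k : ℕ) : Set (V k) := convexHull ℝ (setA k ∪ setC k)
def Delta1 (k : ℕ) : Set (V k) := convexHull ℝ (setA k ∪ setB k)
def Delta2 (k : ℕ) : Set (V k) := convexHull ℝ (setB k ∪ setC k)

/-- The modular block `Ω = closure(Δ₀ \ (Δ₁ ∪ Δ₂))`. -/
def OmegaB (k : ℕ) : Set (V k) := closure (Delta0 k \ (Delta1 k ∪ Delta2 k))

section FaceWeights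

variable {ι E : Type*} [Fintype ι] [NormedAddCommGroup E] [NormedSpace ℝ E]

/-- The barycentric weights on `ι` supported in `s`. -/
def faceWeights (s : Set ι) : Set (ι → ℝ) :=
  {p | (∀ i, 0 ≤ p i) ∧ ∑ i, p i = 1 ∧ ∀ i ∉ s, p i = 0}

theorem convexHull_image_eq_image_faceWeights (v : ι → E) (s : Set ι) :
    convexHull ℝ (v '' s) = Fintype.linearCombination ℝ v '' faceWeights s := by
  classical
  apply Set.Subset.antisymm
  · refine convexHull_min ?_ (Convex.linear_image ?_ _)
    · rintro _ ⟨i, hi, rfl⟩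
      refine ⟨Pi.single i 1, ⟨fun j => ?_, by simp, fun j hj => ?_⟩, by simp⟩
      · by_cases h : j = i <;> simp [h]
      · have : j ≠ i := fun h => hj (h ▸ hi)
        simp [this]
    · rintro p ⟨hp, hp1, hps⟩ q ⟨hq, hq1, hqs⟩ a b ha hb hab
      refine ⟨fun i => ?_, ?_, fun i hi => by simp [hps i hi, hqs i hi]⟩
      · have := mul_nonneg ha (hp i)
        have := mul_nonneg hb (hq i)
        simp only [Pi.add_apply, Pi.smul_apply, smul_eq_mul]
        linarith
      · simp [Finset.sum_add_distrib, ← Finset.mul_sum, hp1, hq1, hab]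
  · rintro _ ⟨p, ⟨hp, hp1, hps⟩, rfl⟩
    have hsub : ∑ i, p i • v i = ∑ i with i ∈ s, p i • v i := by
      rw [Finset.sum_filter]
      refine Finset.sum_congr rfl fun i _ => ?_
      split_ifs with h
      · rfl
      · simp [hps i h]
    have hsub1 : ∑ i with i ∈ s, p i = 1 := by
      rw [Finset.sum_filter, ← hp1]
      refine Finset.sum_congr rfl fun i _ => ?_
      split_ifs with h
      · rfl
      · simp [hps i h]
    rw [Fintype.linearCombination_apply, hsub]
    refine (convex_convexHull ℝ _).sum_mem (fun i _ => hp i) hsub1 fun i hi => ?_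
    exact subset_convexHull ℝ _ ⟨i, by simpa using hi, rfl⟩

theorem exists_linearMap_linearCombination_eq {v : ι → E} {s : Set ι}
    (hv : ∀ p : ι → ℝ, (∀ i ∉ s, p i = 0) → Fintype.linearCombination ℝ v p = 0 → p = 0) :
    ∃ G : E →ₗ[ℝ] (ι → ℝ), ∀ p : ι → ℝ, (∀ i ∉ s, p i = 0) →
      G (Fintype.linearCombination ℝ v p) = p := by
  let W : Submodule ℝ (ι → ℝ) :=
    { carrier := {p | ∀ i ∉ s, p i = 0}
      add_mem' := fun {p q} hp hq i hi => by simp [hp i hi, hq i hi]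
      zero_mem' := fun i _ => rfl
      smul_mem' := fun c p hp i hi => by simp [hp i hi] }
  obtain ⟨g, hg⟩ := ((Fintype.linearCombination ℝ v).comp W.subtype).exists_leftInverse_of_injective
    (LinearMap.ker_eq_bot'.2 fun p hp => Subtype.ext (hv p p.2 hp))
  exact ⟨W.subtype.comp g, fun p hp => congrArg Subtype.val (LinearMap.congr_fun hg ⟨p, hp⟩)⟩

theorem intrinsicFrontier_convexHull_image [FiniteDimensional ℝ E] {v : ι → E} {s : Set ι}
    (hv : ∀ p : ι → ℝ, (∀ i ∉ s, p i = 0) → Fintype.linearCombination ℝ v p = 0 → p = 0) :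
    intrinsicFrontier ℝ (convexHull ℝ (v '' s)) =
      Fintype.linearCombination ℝ v '' {p ∈ faceWeights s | ∃ i ∈ s, p i = 0} := by
  classical
  obtain ⟨G, hG⟩ := exists_linearMap_linearCombination_eq hv
  have hGc : Continuous G := G.continuous_of_finiteDimensional
  have hGv : ∀ i ∈ s, G (v i) = Pi.single i 1 := fun i hi => by
    have := hG (Pi.single i 1) fun j hj => by
      have : j ≠ i := fun h => hj (h ▸ hi)
      simp [this]
    simpa using this
  have hspan : ∀ x ∈ affineSpan ℝ (convexHull ℝ (v '' s)),
      Fintype.linearCombination ℝ v (G x) = x ∧ ∑ i, G x i = 1 ∧ ∀ i ∉ s, G x i = 0 := by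
    intro x hx
    rw [affineSpan_convexHull] at hx
    refine affineSpan_induction hx ?_ ?_
    · rintro _ ⟨i, hi, rfl⟩
      rw [hGv i hi]
      refine ⟨by simp, by simp, fun j hj => ?_⟩
      have : j ≠ i := fun h => hj (h ▸ hi)
      simp [this]
    · rintro c x y z ⟨hx, hx1, hxs⟩ ⟨hy, hy1, hys⟩ ⟨hz, hz1, hzs⟩
      refine ⟨by simp [hx, hy, hz], ?_, fun i hi => by simp [hxs i hi, hys i hi, hzs i hi]⟩
      simp [Finset.sum_add_distrib, Finset.sum_sub_distrib, ← Finset.mul_sum, hx1, hy1, hz1]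
  have hmem : ∀ x ∈ affineSpan ℝ (convexHull ℝ (v '' s)),
      (x ∈ convexHull ℝ (v '' s) ↔ ∀ i ∈ s, 0 ≤ G x i) := by
    intro x hx
    obtain ⟨hx, hx1, hxs⟩ := hspan x hx
    rw [convexHull_image_eq_image_faceWeights]
    constructor
    · rintro ⟨p, ⟨hp, -, hps⟩, rfl⟩ i -
      rw [hG p hps]
      exact hp i
    · intro h
      refine ⟨G x, ⟨fun i => ?_, hx1, hxs⟩, hx⟩
      by_cases hi : i ∈ s
      · exact h i hi
      · exact (hxs i hi).ge
  have hpre : ((↑) ⁻¹' convexHull ℝ (v '' s) : Set (affineSpan ℝ (convexHull ℝ (v '' s)))) =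
      {x : affineSpan ℝ (convexHull ℝ (v '' s)) | ∀ i ∈ s, 0 ≤ G x i} := Set.ext fun x => hmem x x.2
  have hclosed : IsClosed {x : affineSpan ℝ (convexHull ℝ (v '' s)) | ∀ i ∈ s, 0 ≤ G x i} := by
    simp only [Set.ofPred_forall]
    exact isClosed_biInter fun i _ => isClosed_le continuous_const (by fun_prop)
  have hint : ∀ x : affineSpan ℝ (convexHull ℝ (v '' s)),
      x ∈ interior {x : affineSpan ℝ (convexHull ℝ (v '' s)) | ∀ i ∈ s, 0 ≤ G x i} ↔
        ∀ i ∈ s, 0 < G x i := by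
    intro x
    constructor
    · intro hx i hi
      refine lt_of_le_of_ne (interior_subset hx i hi) fun h0 => ?_
      have hvi : v i ∈ affineSpan ℝ (convexHull ℝ (v '' s)) :=
        subset_affineSpan ℝ _ (subset_convexHull ℝ _ ⟨i, hi, rfl⟩)
      let c : ℝ → affineSpan ℝ (convexHull ℝ (v '' s)) := fun t =>
        ⟨AffineMap.lineMap (x : E) (v i) t, AffineMap.lineMap_mem t x.2 hvi⟩
      have hcont : Continuous c := AffineMap.lineMap_continuous.subtype_mk _
      have hc0 : c 0 = x := Subtype.ext (AffineMap.lineMap_apply_zero _ _)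
      have hev : ∀ᶠ t : ℝ in nhds 0,
          c t ∈ {x : affineSpan ℝ (convexHull ℝ (v '' s)) | ∀ i ∈ s, 0 ≤ G x i} :=
        hcont.continuousAt.eventually (by rw [hc0]; exact mem_interior_iff_mem_nhds.1 hx)
      obtain ⟨t, ht, htneg⟩ := ((hev.filter_mono nhdsWithin_le_nhds).and
        (self_mem_nhdsWithin : Set.Iio (0 : ℝ) ∈ nhdsWithin 0 (Set.Iio 0))).exists
      have hti : 0 ≤ G (AffineMap.lineMap (x : E) (v i) t) i := ht i hi
      rw [AffineMap.lineMap_apply_module, map_add, map_smul, map_smul, hGv i hi] at hti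
      simp only [Pi.add_apply, Pi.smul_apply, ← h0, Pi.single_eq_same, smul_eq_mul] at hti
      have : t < 0 := htneg
      linarith
    · intro hx
      refine mem_interior.2 ⟨{x | ∀ i ∈ s, 0 < G x i}, fun z hz i hi => (hz i hi).le, ?_, hx⟩
      simp only [Set.ofPred_forall]
      exact s.toFinite.isOpen_biInter fun i _ => isOpen_lt continuous_const (by fun_prop)
  ext x
  simp only [mem_intrinsicFrontier, hpre, hclosed.frontier_eq, Set.mem_sdiff, hint]
  constructor
  · rintro ⟨y, ⟨hy, hy0⟩, rfl⟩
    obtain ⟨h, h1, hs⟩ := hspan y y.2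
    push Not at hy0
    obtain ⟨i, hi, hi0⟩ := hy0
    refine ⟨G y, ⟨⟨fun j => ?_, h1, hs⟩, i, hi, le_antisymm hi0 (hy i hi)⟩, h⟩
    by_cases hj : j ∈ s
    · exact hy j hj
    · exact (hs j hj).ge
  · rintro ⟨p, ⟨hp, i, hi, hpi⟩, rfl⟩
    have hmem' : Fintype.linearCombination ℝ v p ∈ convexHull ℝ (v '' s) := by
      rw [convexHull_image_eq_image_faceWeights]
      exact ⟨p, hp, rfl⟩
    refine ⟨⟨_, subset_affineSpan ℝ _ hmem'⟩, ⟨fun j _ => ?_, fun h => ?_⟩, rfl⟩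
    · simpa only [hG p hp.2.2] using hp.1 j
    · have := h i hi
      simp only [hG p hp.2.2, hpi, lt_irrefl] at this

end FaceWeights

theorem sum_le_sum_of_forall_eq_max {ι : Type*} [Fintype ι] {b b' m : ι → ℝ} {c : ℝ} (hc : 0 < c)
    (hm : ∀ i, 0 ≤ m i) (hb : ∀ i, b i = max 0 (2 * ∑ j, b j - c * m i))
    (hb' : ∀ i, b' i = max 0 (2 * ∑ j, b' j - c * m i))
    (h0 : ∑ j, b j = 0 → ∃ i, m i = 0) : ∑ j, b' j ≤ ∑ j, b j := by
  by_contra! hlt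
  have hbn : ∀ i, 0 ≤ b i := fun i => hb i ▸ le_max_left _ _
  have hbn' : ∀ i, 0 ≤ b' i := fun i => hb' i ▸ le_max_left _ _
  have hB : 0 ≤ ∑ j, b j := Finset.sum_nonneg fun i _ => hbn i
  have hB' : 0 < ∑ j, b' j := hB.trans_lt hlt
  have hmpos : ∀ i, 0 < m i := fun i => (hm i).lt_of_ne' fun h => by
    have h1 := Finset.single_le_sum (fun j _ => hbn' j) (Finset.mem_univ i)
    have h2 : 2 * ∑ j, b' j - c * m i ≤ b' i := hb' i ▸ le_max_right _ _
    rw [h] at h2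
    linarith
  have hBpos : 0 < ∑ j, b j := hB.lt_of_ne' fun h => by
    obtain ⟨i, hi⟩ := h0 h
    exact (hmpos i).ne' hi
  have hstep : ∀ i, 0 < b' i → (∑ j, b' j) * b i < (∑ j, b j) * b' i := fun i hi => by
    have h2 : 2 * ∑ j, b' j - c * m i ≤ b' i := hb' i ▸ le_max_right _ _
    rcases max_choice 0 (2 * ∑ j, b j - c * m i) with h | h
    · rw [hb i, h, mul_zero]
      positivity
    · rw [hb i, h]
      nlinarith [mul_le_mul_of_nonneg_left h2 hB, mul_pos (mul_pos hc (hmpos i)) (sub_pos.2 hlt)]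
  have hstep' : ∀ i, (∑ j, b' j) * b i ≤ (∑ j, b j) * b' i := fun i => by
    rcases (hbn' i).lt_or_eq with hi | hi
    · exact (hstep i hi).le
    · have h2 : 2 * ∑ j, b' j - c * m i ≤ b' i := hb' i ▸ le_max_right _ _
      have : b i = 0 := by
        rw [hb i]
        exact max_eq_left (by linarith)
      rw [this, ← hi]
      simp
  obtain ⟨i, -, hi⟩ := Finset.exists_lt_of_sum_lt (s := Finset.univ) (f := fun _ : ι => (0 : ℝ))
    (g := b') (by simpa using hB')
  have := Finset.sum_lt_sum (fun i _ => hstep' i) ⟨i, Finset.mem_univ i, hstep i hi⟩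
  rw [← Finset.mul_sum, ← Finset.mul_sum, mul_comm] at this
  exact lt_irrefl _ this

theorem exists_forall_eq_max {ι : Type*} [Fintype ι] [Nonempty ι] {m : ι → ℝ} {c : ℝ}
    (hc : 0 < c) (hm : ∀ i, 0 < m i)
    (hle : 1 ≤ ∑ i, max 0 (2 - c * m i)) :
    ∃ b : ι → ℝ, 0 < ∑ j, b j ∧ ∀ i, b i = max 0 (2 * ∑ j, b j - c * m i) := by
  obtain ⟨i₀, hi₀⟩ := Finite.exists_min m
  have hcont : ContinuousOn (fun t : ℝ => ∑ i, max 0 (2 * t - c * m i) - t)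
      (Set.uIcc (c * m i₀ / 2) 1) := by fun_prop
  have hpos : 0 < c * m i₀ / 2 := by have := hm i₀; positivity
  have hneg : ∑ i, max 0 (2 * (c * m i₀ / 2) - c * m i) - c * m i₀ / 2 ≤ 0 := by
    rw [Finset.sum_eq_zero fun i _ => max_eq_left ?_]
    · linarith
    · nlinarith [hi₀ i]
  obtain ⟨t, ht, ht0⟩ := intermediate_value_uIcc hcont
    (show (0 : ℝ) ∈ _ from Set.mem_uIcc_of_le hneg (by simpa using hle))
  have htpos : 0 < t := (lt_min hpos one_pos).trans_le ht.1
  have hsum : ∑ i, max 0 (2 * t - c * m i) = t := by simpa [sub_eq_zero] using ht0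
  exact ⟨fun i => max 0 (2 * t - c * m i), by rwa [hsum], fun i => by rw [hsum]⟩

/-- The vertices `A_j`, `B_j`, `C_j`, indexed so that `τ` raises the first index. -/
def vtx (k : ℕ) (q : Fin 3 × Fin k) : V k := ![vA k, vB k, vC k] q.1 q.2

/-- The point with weights `p` on the vertices. -/
abbrev bary (k : ℕ) : (Fin 3 × Fin k → ℝ) →ₗ[ℝ] V k := Fintype.linearCombination ℝ (vtx k)

/-- Weights of the join of the boundaries of the `k` triangles `A_j B_j C_j`. -/
def joinWeights (k : ℕ) : Set (Fin 3 × Fin k → ℝ) :=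
  {p | (∀ q, 0 ≤ p q) ∧ ∑ q, p q = 1 ∧ ∀ j, ∃ i, p (i, j) = 0}

/-- The subcomplex obtained from the join by removing the open facet `A ∪ C`. -/
def discWeights (k : ℕ) : Set (Fin 3 × Fin k → ℝ) :=
  {p ∈ joinWeights k | ∃ j, p (0, j) = 0 ∨ p (2, j) = 0}

/-- The subcomplex obtained from the join by removing the open facets `A ∪ B`, `B ∪ C`
and `C ∪ A`. -/
def blockWeights (k : ℕ) : Set (Fin 3 × Fin k → ℝ) :=
  {p ∈ joinWeights k | ∀ i, ∃ j, p (i, j) = 0 ∨ p (i + 1, j) = 0}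

theorem sum_fin_three_prod {k : ℕ} {M : Type*} [AddCommMonoid M] (f : Fin 3 × Fin k → M) :
    ∑ q, f q = ∑ j, f (0, j) + ∑ j, f (1, j) + ∑ j, f (2, j) := by
  rw [Fintype.sum_prod_type, Fin.sum_univ_three]

theorem sum_mul_two_sub_ite_div {k : ℕ} (f : Fin k → ℝ) (c : ℝ) (i : Fin k) :
    ∑ j, f j * ((2 - if i = j then 1 else 0) / c) = (2 * ∑ j, f j - f i) / c := by
  simp_rw [← mul_div_assoc, ← Finset.sum_div, mul_sub, Finset.sum_sub_distrib, ← Finset.sum_mul]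
  simp [mul_comm]

theorem bary_inl {k : ℕ} (p : Fin 3 × Fin k → ℝ) (i : Fin k) :
    bary k p (.inl i) = p (0, i) + (2 * ∑ j, p (1, j) - p (1, i)) / (2 * (2 * (k : ℝ) - 1)) := by
  rw [Fintype.linearCombination_apply, sum_fin_three_prod, ← sum_mul_two_sub_ite_div]
  simp [vtx, vA, vB, vC, Finset.sum_apply]

theorem bary_inr {k : ℕ} (p : Fin 3 × Fin k → ℝ) (i : Fin k) :
    bary k p (.inr i) = p (2, i) + (2 * ∑ j, p (1, j) - p (1, i)) / (2 * (2 * (k : ℝ) - 1)) := by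
  rw [Fintype.linearCombination_apply, sum_fin_three_prod, ← sum_mul_two_sub_ite_div]
  simp [vtx, vA, vB, vC, Finset.sum_apply, add_comm]

theorem two_mul_sub_one_pos {k : ℕ} (hk : 2 ≤ k) : (0 : ℝ) < 2 * (2 * (k : ℝ) - 1) := by
  have : (2 : ℝ) ≤ k := by exact_mod_cast hk
  linarith

theorem sum_bary {k : ℕ} (hk : 2 ≤ k) (p : Fin 3 × Fin k → ℝ) : ∑ c, bary k p c = ∑ q, p q := by
  have hn := two_mul_sub_one_pos hk
  have hS : ∑ i, (2 * ∑ j, p (1, j) - p (1, i)) / (2 * (2 * (k : ℝ) - 1)) =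
      (∑ j, p (1, j)) / 2 := by
    rw [← Finset.sum_div, Finset.sum_sub_distrib]
    simp only [Finset.sum_const, Finset.card_univ, Fintype.card_fin, nsmul_eq_mul]
    rw [div_eq_div_iff hn.ne' two_ne_zero]
    ring
  simp only [Fintype.sum_sum_type, bary_inl, bary_inr, Finset.sum_add_distrib, hS,
    sum_fin_three_prod]
  ring

theorem bary_nonneg {k : ℕ} (hk : 2 ≤ k) {p : Fin 3 × Fin k → ℝ} (hp : ∀ q, 0 ≤ p q)
    (c : Fin k ⊕ Fin k) : 0 ≤ bary k p c := by
  have hn := two_mul_sub_one_pos hk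
  have h : ∀ i, 0 ≤ (2 * ∑ j, p (1, j) - p (1, i)) / (2 * (2 * (k : ℝ) - 1)) := fun i => by
    have := Finset.single_le_sum (f := fun j => p (1, j)) (fun j _ => hp (1, j)) (Finset.mem_univ i)
    have := hp (1, i)
    exact div_nonneg (by linarith) hn.le
  cases c with
  | inl i => rw [bary_inl]; exact add_nonneg (hp _) (h i)
  | inr i => rw [bary_inr]; exact add_nonneg (hp _) (h i)

theorem joinWeights_eq_max {k : ℕ} (hk : 2 ≤ k) {p : Fin 3 × Fin k → ℝ} (hp : p ∈ joinWeights k)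
    (i : Fin k) : p (1, i) = max 0 (2 * ∑ j, p (1, j) -
      2 * (2 * (k : ℝ) - 1) * min (bary k p (.inl i)) (bary k p (.inr i))) := by
  have hn := two_mul_sub_one_pos hk
  rw [bary_inl, bary_inr, min_add_add_right, mul_add, mul_div_cancel₀ _ hn.ne']
  obtain ⟨hp, -, h⟩ := hp
  obtain ⟨l, hl⟩ := h i
  have hmin : 0 ≤ min (p (0, i)) (p (2, i)) := le_min (hp _) (hp _)
  have h1 := hp (1, i)
  by_cases h1' : p (1, i) = 0
  · rw [h1', max_eq_left]
    nlinarith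
  · have hmin0 : min (p (0, i)) (p (2, i)) = 0 := by
      fin_cases l
      · exact (min_eq_left (hl.le.trans (hp _))).trans hl
      · exact absurd hl h1'
      · exact (min_eq_right (hl.le.trans (hp _))).trans hl
    rw [hmin0, max_eq_right] <;> linarith

theorem sum_middle_le_of_bary_eq {k : ℕ} (hk : 2 ≤ k) {p p' : Fin 3 × Fin k → ℝ}
    (hp : p ∈ discWeights k) (hp' : p' ∈ joinWeights k) (h : bary k p = bary k p') :
    ∑ j, p' (1, j) ≤ ∑ j, p (1, j) := by
  refine sum_le_sum_of_forall_eq_max (two_mul_sub_one_pos hk)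
    (fun i => le_min (bary_nonneg hk hp.1.1 (.inl i)) (bary_nonneg hk hp.1.1 (.inr i)))
    (joinWeights_eq_max hk hp.1) (h ▸ joinWeights_eq_max hk hp') fun h0 => ?_
  have h1 : ∀ j, p (1, j) = 0 := fun j =>
    (Finset.sum_eq_zero_iff_of_nonneg fun j _ => hp.1.1 (1, j)).1 h0 j (Finset.mem_univ j)
  obtain ⟨j, hj⟩ := hp.2
  refine ⟨j, ?_⟩
  rw [bary_inl, bary_inr, h0, h1]
  rcases hj with hj | hj
  · simp [hj, hp.1.1 (2, j)]
  · simp [hj, hp.1.1 (0, j)]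

theorem injOn_bary_discWeights {k : ℕ} (hk : 2 ≤ k) : Set.InjOn (bary k) (discWeights k) := by
  intro p hp p' hp' h
  have hsum : ∑ j, p (1, j) = ∑ j, p' (1, j) :=
    le_antisymm (sum_middle_le_of_bary_eq hk hp' hp.1 h.symm) (sum_middle_le_of_bary_eq hk hp hp'.1 h)
  have h1 : ∀ i, p (1, i) = p' (1, i) := fun i => by
    rw [joinWeights_eq_max hk hp.1, joinWeights_eq_max hk hp'.1, h, hsum]
  ext ⟨l, i⟩
  have hl := congrFun h (.inl i)
  have hr := congrFun h (.inr i)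
  rw [bary_inl, bary_inl, hsum, h1] at hl
  rw [bary_inr, bary_inr, hsum, h1] at hr
  fin_cases l
  · exact add_right_cancel hl
  · exact h1 i
  · exact add_right_cancel hr

theorem setA_union_setB (k : ℕ) : setA k ∪ setB k = vtx k '' {q | q.1 ≠ 2} := by
  ext x
  simp [setA, setB, vtx, Fin.exists_fin_succ, Set.mem_image]

theorem setB_union_setC (k : ℕ) : setB k ∪ setC k = vtx k '' {q | q.1 ≠ 0} := by
  ext x
  simp [setC, setB, vtx, Fin.exists_fin_succ, Set.mem_image]

theorem setA_union_setC (k : ℕ) : setA k ∪ setC k = vtx k '' {q | q.1 ≠ 1} := by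
  ext x
  simp [setA, setC, vtx, Fin.exists_fin_succ, Set.mem_image]

theorem delta0_eq (k : ℕ) : Delta0 k = bary k '' faceWeights {q | q.1 ≠ 1} := by
  rw [Delta0, setA_union_setC, convexHull_image_eq_image_faceWeights]

theorem delta1_eq (k : ℕ) : Delta1 k = bary k '' faceWeights {q | q.1 ≠ 2} := by
  rw [Delta1, setA_union_setB, convexHull_image_eq_image_faceWeights]

theorem delta2_eq (k : ℕ) : Delta2 k = bary k '' faceWeights {q | q.1 ≠ 0} := by
  rw [Delta2, setB_union_setC, convexHull_image_eq_image_faceWeights]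

theorem mem_delta0_iff {k : ℕ} (hk : 2 ≤ k) (x : V k) :
    x ∈ Delta0 k ↔ (∀ c, 0 ≤ x c) ∧ ∑ c, x c = 1 := by
  rw [delta0_eq]
  constructor
  · rintro ⟨p, ⟨hp, hp1, -⟩, rfl⟩
    exact ⟨bary_nonneg hk hp, (sum_bary hk p).trans hp1⟩
  · rintro ⟨hx, hx1⟩
    let p : Fin 3 × Fin k → ℝ := fun q => ![fun j => x (.inl j), 0, fun j => x (.inr j)] q.1 q.2
    have hpx : bary k p = x := by
      ext c
      cases c <;> simp [bary_inl, bary_inr, p]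
    refine ⟨p, ⟨?_, ?_, ?_⟩, hpx⟩
    · rintro ⟨l, j⟩
      fin_cases l <;> simp [p, hx]
    · rw [← sum_bary hk, hpx, hx1]
    · rintro ⟨l, j⟩ hl
      obtain rfl : l = 1 := by simpa using hl
      rfl

theorem bary_image_discWeights {k : ℕ} (hk : 2 ≤ k) : bary k '' discWeights k = Delta0 k := by
  have hn := two_mul_sub_one_pos hk
  have : Nonempty (Fin k) := ⟨⟨0, by omega⟩⟩
  apply Set.Subset.antisymm
  · rintro _ ⟨p, ⟨⟨hp, hp1, -⟩, -⟩, rfl⟩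
    exact (mem_delta0_iff hk _).2 ⟨bary_nonneg hk hp, (sum_bary hk p).trans hp1⟩
  · intro x hx
    obtain ⟨hx0, hx1⟩ := (mem_delta0_iff hk x).1 hx
    by_cases hm : ∃ i : Fin k, min (x (.inl i)) (x (.inr i)) = 0
    · rw [delta0_eq] at hx
      obtain ⟨p, ⟨hp, hp1, hps⟩, rfl⟩ := hx
      refine ⟨p, ⟨⟨hp, hp1, fun j => ⟨1, hps _ (by simp)⟩⟩, ?_⟩, rfl⟩
      have h1 : ∀ j, p (1, j) = 0 := fun j => hps _ (by simp)
      obtain ⟨i, hi⟩ := hm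
      refine ⟨i, ?_⟩
      rcases min_choice (bary k p (.inl i)) (bary k p (.inr i)) with h | h
      · left
        simpa [bary_inl, h1] using h.symm.trans hi
      · right
        simpa [bary_inr, h1] using h.symm.trans hi
    · push Not at hm
      set m : Fin k → ℝ := fun i => min (x (.inl i)) (x (.inr i)) with hmdef
      have hmpos : ∀ i, 0 < m i := fun i => (le_min (hx0 _) (hx0 _)).lt_of_ne' (hm i)
      have hmsum : 2 * ∑ i, m i ≤ 1 := by
        rw [← hx1, Fintype.sum_sum_type, two_mul]
        exact add_le_add (Finset.sum_le_sum fun i _ => min_le_left _ _)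
          (Finset.sum_le_sum fun i _ => min_le_right _ _)
      obtain ⟨b, hbpos, hb⟩ := exists_forall_eq_max hn hmpos (by
        have h := Finset.sum_le_sum fun (i : Fin k) (_ : i ∈ Finset.univ) =>
          le_max_right 0 (2 - 2 * (2 * (k : ℝ) - 1) * m i)
        rw [Finset.sum_sub_distrib, ← Finset.mul_sum] at h
        simp only [Finset.sum_const, Finset.card_univ, Fintype.card_fin, nsmul_eq_mul] at h
        nlinarith)
      let d : Fin k → ℝ := fun i => (2 * ∑ j, b j - b i) / (2 * (2 * (k : ℝ) - 1))
      have hbn : ∀ i, 0 ≤ b i := fun i => hb i ▸ le_max_left _ _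
      have hdm : ∀ i, d i ≤ m i := fun i => by
        have h2 : 2 * ∑ j, b j - 2 * (2 * (k : ℝ) - 1) * m i ≤ b i := hb i ▸ le_max_right _ _
        rw [div_le_iff₀ hn]
        linarith
      have hdm' : ∀ i, b i ≠ 0 → d i = m i := fun i hi => by
        have h2 : b i = 2 * ∑ j, b j - 2 * (2 * (k : ℝ) - 1) * m i := by
          rcases max_choice 0 (2 * ∑ j, b j - 2 * (2 * (k : ℝ) - 1) * m i) with h | h
          · exact absurd ((hb i).trans h) hi
          · exact (hb i).trans h
        rw [div_eq_iff hn.ne']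
        linarith
      let p : Fin 3 × Fin k → ℝ :=
        fun q => ![fun j => x (.inl j) - d j, b, fun j => x (.inr j) - d j] q.1 q.2
      have hpx : bary k p = x := by
        ext c
        cases c <;> simp [bary_inl, bary_inr, p, d]
      have hmin : ∀ i, b i ≠ 0 → p (0, i) = 0 ∨ p (2, i) = 0 := fun i hi => by
        rcases min_choice (x (.inl i)) (x (.inr i)) with h | h
        · left
          exact sub_eq_zero.2 ((hdm' i hi).trans h).symm
        · right
          exact sub_eq_zero.2 ((hdm' i hi).trans h).symm
      refine ⟨p, ⟨⟨?_, ?_, fun i => ?_⟩, ?_⟩, hpx⟩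
      · rintro ⟨l, j⟩
        fin_cases l
        · exact sub_nonneg.2 ((hdm j).trans (min_le_left _ _))
        · exact hbn j
        · exact sub_nonneg.2 ((hdm j).trans (min_le_right _ _))
      · rw [← sum_bary hk, hpx, hx1]
      · by_cases hi : b i = 0
        · exact ⟨1, hi⟩
        · rcases hmin i hi with h | h
          · exact ⟨0, h⟩
          · exact ⟨2, h⟩
      · obtain ⟨i, -, hi⟩ := Finset.exists_ne_zero_of_sum_ne_zero hbpos.ne'
        exact ⟨i, hmin i hi⟩

theorem isCompact_blockWeights (k : ℕ) : IsCompact (blockWeights k) := by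
  have h : blockWeights k = stdSimplex ℝ (Fin 3 × Fin k) ∩
      ((⋂ j, ⋃ i, {p | p (i, j) = 0}) ∩ ⋂ i, ⋃ j, {p | p (i, j) = 0 ∨ p (i + 1, j) = 0}) := by
    ext p
    simp [blockWeights, joinWeights, stdSimplex, and_assoc]
  rw [h]
  refine (isCompact_stdSimplex ℝ _).inter_right (IsClosed.inter ?_ ?_)
  · exact isClosed_iInter fun j => isClosed_iUnion_of_finite fun i =>
      isClosed_eq (continuous_apply _) continuous_const
  · exact isClosed_iInter fun i => isClosed_iUnion_of_finite fun j =>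
      (isClosed_eq (continuous_apply _) continuous_const).union
        (isClosed_eq (continuous_apply _) continuous_const)

theorem blockWeights_subset_discWeights (k : ℕ) : blockWeights k ⊆ discWeights k := by
  rintro p ⟨hp, h⟩
  obtain ⟨j, hj⟩ := h 2
  exact ⟨hp, j, hj.symm⟩

/-- The weights of the points of `Δ₀ \ (Δ₁ ∪ Δ₂)`. -/
def coreWeights (k : ℕ) : Set (Fin 3 × Fin k → ℝ) :=
  {p ∈ discWeights k | (∃ j, p (0, j) ≠ 0) ∧ ∃ j, p (2, j) ≠ 0}

theorem coreWeights_subset_blockWeights (k : ℕ) : coreWeights k ⊆ blockWeights k := by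
  rintro p ⟨⟨hp, h⟩, ⟨a, ha⟩, c, hc⟩
  refine ⟨hp, fun i => ?_⟩
  fin_cases i
  · obtain ⟨l, hl⟩ := hp.2.2 c
    refine ⟨c, ?_⟩
    fin_cases l
    · exact Or.inl hl
    · exact Or.inr hl
    · exact absurd hl hc
  · obtain ⟨l, hl⟩ := hp.2.2 a
    refine ⟨a, ?_⟩
    fin_cases l
    · exact absurd hl ha
    · exact Or.inl hl
    · exact Or.inr hl
  · obtain ⟨j, hj⟩ := h
    exact ⟨j, hj.symm⟩

theorem faceWeights_subset_discWeights {k : ℕ} (hk : 2 ≤ k) {m : Fin 3} (hm : m ≠ 1) :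
    faceWeights {q : Fin 3 × Fin k | q.1 ≠ m} ⊆ discWeights k := by
  rintro p ⟨hp, hp1, hps⟩
  refine ⟨⟨hp, hp1, fun j => ⟨m, hps _ (by simp)⟩⟩, ⟨0, by omega⟩, ?_⟩
  fin_cases m
  · exact Or.inl (hps _ (by simp))
  · exact absurd rfl hm
  · exact Or.inr (hps _ (by simp))

theorem bary_image_coreWeights {k : ℕ} (hk : 2 ≤ k) :
    bary k '' coreWeights k = Delta0 k \ (Delta1 k ∪ Delta2 k) := by
  rw [← bary_image_discWeights hk, delta1_eq, delta2_eq]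
  ext x
  constructor
  · rintro ⟨p, ⟨hp, ⟨a, ha⟩, c, hc⟩, rfl⟩
    refine ⟨⟨p, hp, rfl⟩, ?_⟩
    rintro (⟨q, hq, hqp⟩ | ⟨q, hq, hqp⟩)
    · obtain rfl := injOn_bary_discWeights hk
        (faceWeights_subset_discWeights hk (by decide) hq) hp hqp
      exact hc (hq.2.2 _ (by simp))
    · obtain rfl := injOn_bary_discWeights hk
        (faceWeights_subset_discWeights hk (by decide) hq) hp hqp
      exact ha (hq.2.2 _ (by simp))
  · rintro ⟨⟨p, hp, rfl⟩, hn⟩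
    refine ⟨p, ⟨hp, ?_, ?_⟩, rfl⟩
    · by_contra! h
      refine hn (Or.inr ⟨p, ⟨hp.1.1, hp.1.2.1, ?_⟩, rfl⟩)
      rintro ⟨l, j⟩ hl
      obtain rfl : l = 0 := by simpa using hl
      exact h j
    · by_contra! h
      refine hn (Or.inl ⟨p, ⟨hp.1.1, hp.1.2.1, ?_⟩, rfl⟩)
      rintro ⟨l, j⟩ hl
      obtain rfl : l = 2 := by simpa using hl
      exact h j

theorem mem_closure_coreWeights_of_segment {k : ℕ} {p r : Fin 3 × Fin k → ℝ}
    (hp : ∀ q, 0 ≤ p q) (hp1 : ∑ q, p q = 1) (hr : ∀ q, 0 ≤ r q) (hr1 : ∑ q, r q = 1)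
    (hjoin : ∀ j, ∃ i, p (i, j) = 0 ∧ r (i, j) = 0)
    (hdisc : ∃ j, (p (0, j) = 0 ∧ r (0, j) = 0) ∨ (p (2, j) = 0 ∧ r (2, j) = 0))
    (h0 : ∃ j, 0 < p (0, j) ∨ 0 < r (0, j)) (h2 : ∃ j, 0 < p (2, j) ∨ 0 < r (2, j)) :
    p ∈ closure (coreWeights k) := by
  have hcont : Continuous fun t : ℝ => (1 - t) • p + t • r := by fun_prop
  have hlim : Filter.Tendsto (fun t : ℝ => (1 - t) • p + t • r) (nhdsWithin 0 (Set.Ioi 0))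
      (nhds p) := by
    simpa using (hcont.tendsto 0).mono_left nhdsWithin_le_nhds
  refine mem_closure_of_tendsto hlim ?_
  filter_upwards [Ioo_mem_nhdsGT (zero_lt_one' ℝ)] with t ⟨ht0, ht1⟩
  have ht1' : 0 < 1 - t := sub_pos.2 ht1
  have hpos : ∀ q, 0 < p q ∨ 0 < r q → ((1 - t) • p + t • r) q ≠ 0 := fun q h => by
    have := hp q
    have := hr q
    simp only [Pi.add_apply, Pi.smul_apply, smul_eq_mul]
    rcases h with h | h <;> positivity
  have hzero : ∀ q, p q = 0 ∧ r q = 0 → ((1 - t) • p + t • r) q = 0 := fun q h => by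
    simp [h.1, h.2]
  refine ⟨⟨⟨fun q => ?_, ?_, fun j => (hjoin j).imp fun i => hzero _⟩,
    hdisc.imp fun j => Or.imp (hzero _) (hzero _)⟩, h0.imp fun j => hpos _, h2.imp fun j => hpos _⟩
  · have := hp q
    have := hr q
    simp only [Pi.add_apply, Pi.smul_apply, smul_eq_mul]
    positivity
  · simp [Finset.sum_add_distrib, ← Finset.mul_sum, hp1, hr1]

theorem blockWeights_subset_closure_coreWeights {k : ℕ} (hk : 2 ≤ k) :
    blockWeights k ⊆ closure (coreWeights k) := by
  have : Nontrivial (Fin k) := Fin.nontrivial_iff_two_le.2 hk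
  have hs : ∀ q q' : Fin 3 × Fin k, 0 ≤ (Pi.single q 1 : Fin 3 × Fin k → ℝ) q' := fun q q' => by
    by_cases h : q' = q <;> simp [h]
  rintro p ⟨⟨hp, hp1, hj⟩, h⟩
  by_cases h0 : ∃ j, p (0, j) ≠ 0 <;> by_cases h2 : ∃ j, p (2, j) ≠ 0
  · obtain ⟨j, hj'⟩ := h 2
    exact subset_closure ⟨⟨⟨hp, hp1, hj⟩, j, hj'.symm⟩, h0, h2⟩
  · push Not at h2
    obtain ⟨a, ha⟩ := h0
    obtain ⟨j, hj'⟩ := h 0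
    obtain ⟨i, hi⟩ := exists_ne j
    refine mem_closure_coreWeights_of_segment hp hp1 (hs (2, j)) (by simp) (fun l => ?_)
      ⟨i, Or.inr ⟨h2 i, by simp [hi]⟩⟩ ⟨a, Or.inl ((hp _).lt_of_ne' ha)⟩ ⟨j, Or.inr (by simp)⟩
    by_cases hl : l = j
    · subst hl
      rcases hj' with hj' | hj'
      · exact ⟨0, hj', by simp⟩
      · exact ⟨1, hj', by simp⟩
    · exact ⟨2, h2 l, by simp [hl]⟩
  · push Not at h0
    obtain ⟨c, hc⟩ := h2
    obtain ⟨j, hj'⟩ := h 1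
    obtain ⟨i, hi⟩ := exists_ne j
    refine mem_closure_coreWeights_of_segment hp hp1 (hs (0, j)) (by simp) (fun l => ?_)
      ⟨i, Or.inl ⟨h0 i, by simp [hi]⟩⟩ ⟨j, Or.inr (by simp)⟩ ⟨c, Or.inl ((hp _).lt_of_ne' hc)⟩
    by_cases hl : l = j
    · subst hl
      rcases hj' with hj' | hj'
      · exact ⟨1, hj', by simp⟩
      · exact ⟨2, hj', by simp⟩
    · exact ⟨0, h0 l, by simp [hl]⟩
  · push Not at h0 h2
    obtain ⟨i, j, hij⟩ := exists_pair_ne (Fin k)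
    refine mem_closure_coreWeights_of_segment
      (r := (2⁻¹ : ℝ) • Pi.single (0, i) 1 + (2⁻¹ : ℝ) • Pi.single (2, j) 1) hp hp1
      (fun q => ?_) ?_ (fun l => ?_) ⟨j, Or.inl ⟨h0 j, by simp [hij.symm]⟩⟩
      ⟨i, Or.inr (by simp)⟩ ⟨j, Or.inr (by simp)⟩
    · have := hs (0, i) q
      have := hs (2, j) q
      simp only [Pi.add_apply, Pi.smul_apply, smul_eq_mul]
      positivity
    · simp [Finset.sum_add_distrib, ← Finset.mul_sum]
      norm_num
    · by_cases hl : l = i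
      · exact ⟨2, h2 l, by simp [hl, hij]⟩
      · exact ⟨0, h0 l, by simp [hl]⟩

theorem omegaB_eq {k : ℕ} (hk : 2 ≤ k) : OmegaB k = bary k '' blockWeights k := by
  have hcont : Continuous (bary k) := (bary k).continuous_of_finiteDimensional
  rw [OmegaB, ← bary_image_coreWeights hk]
  apply Set.Subset.antisymm
  · exact closure_minimal (Set.image_mono (coreWeights_subset_blockWeights k))
      ((isCompact_blockWeights k).image hcont).isClosed
  · exact (Set.image_mono (blockWeights_subset_closure_coreWeights hk)).trans
      (image_closure_subset_closure_image hcont)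

/-- The permutation `A_j ↦ B_j ↦ C_j ↦ A_j` of the vertex indices. -/
def rotIndex (k : ℕ) : Fin 3 × Fin k ≃ Fin 3 × Fin k :=
  (Equiv.addRight 1).prodCongr (Equiv.refl _)

/-- The action of `rotIndex` on weights. -/
def rotWeights (k : ℕ) : (Fin 3 × Fin k → ℝ) →ₗ[ℝ] (Fin 3 × Fin k → ℝ) :=
  LinearMap.funLeft ℝ ℝ (rotIndex k).symm

theorem rotWeights_apply_rotIndex {k : ℕ} (p : Fin 3 × Fin k → ℝ) (q : Fin 3 × Fin k) :
    rotWeights k p (rotIndex k q) = p q := by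
  simp [rotWeights, LinearMap.funLeft_apply]

theorem rotWeights_apply_succ {k : ℕ} (p : Fin 3 × Fin k → ℝ) (i : Fin 3) (j : Fin k) :
    rotWeights k p (i + 1, j) = p (i, j) :=
  rotWeights_apply_rotIndex p (i, j)

theorem rotWeights_rotWeights_rotWeights {k : ℕ} (p : Fin 3 × Fin k → ℝ) :
    rotWeights k (rotWeights k (rotWeights k p)) = p := by
  ext ⟨i, j⟩
  obtain ⟨l, rfl⟩ : ∃ l : Fin 3, l + 1 + 1 + 1 = i := ⟨i, by fin_cases i <;> rfl⟩
  simp only [rotWeights_apply_succ]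
  congr 2
  fin_cases l <;> rfl

theorem sum_rotWeights {k : ℕ} (p : Fin 3 × Fin k → ℝ) : ∑ q, rotWeights k p q = ∑ q, p q :=
  Equiv.sum_comp (rotIndex k).symm p

theorem rotWeights_mem_blockWeights {k : ℕ} {p : Fin 3 × Fin k → ℝ} (hp : p ∈ blockWeights k) :
    rotWeights k p ∈ blockWeights k := by
  obtain ⟨⟨hp, hp1, hj⟩, h⟩ := hp
  refine ⟨⟨fun q => hp _, (sum_rotWeights p).trans hp1, fun j => ?_⟩, fun i => ?_⟩
  · obtain ⟨i, hi⟩ := hj j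
    exact ⟨i + 1, (rotWeights_apply_succ p i j).trans hi⟩
  · obtain ⟨l, rfl⟩ : ∃ l : Fin 3, l + 1 = i := ⟨i - 1, by simp⟩
    simpa only [rotWeights_apply_succ] using h l

theorem rotWeights_image_faceWeights {k : ℕ} (s : Set (Fin 3 × Fin k)) :
    rotWeights k '' faceWeights s = faceWeights (rotIndex k '' s) := by
  ext p
  constructor
  · rintro ⟨p, ⟨hp, hp1, hps⟩, rfl⟩
    refine ⟨fun q => hp _, (sum_rotWeights p).trans hp1, fun q hq => ?_⟩
    exact hps _ fun h => hq ⟨_, h, by simp⟩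
  · rintro ⟨hp, hp1, hps⟩
    refine ⟨p ∘ rotIndex k, ⟨fun q => hp _, ?_, fun q hq => ?_⟩, ?_⟩
    · exact (Equiv.sum_comp (rotIndex k) p).trans hp1
    · exact hps _ fun h => hq (by simpa using h)
    · ext q
      simp [rotWeights, LinearMap.funLeft_apply]

/-- The weights of the boundary of the simplex omitting the vertices with first index `m`. -/
def boundaryWeights (k : ℕ) (m : Fin 3) : Set (Fin 3 × Fin k → ℝ) :=
  {p ∈ faceWeights {q | q.1 ≠ m} | ∃ q ∈ {q : Fin 3 × Fin k | q.1 ≠ m}, p q = 0}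

theorem rotWeights_image_boundaryWeights (k : ℕ) (m : Fin 3) :
    rotWeights k '' boundaryWeights k m = boundaryWeights k (m + 1) := by
  have hs : rotIndex k '' {q | q.1 ≠ m} = {q | q.1 ≠ m + 1} := by
    ext ⟨i, j⟩
    simp only [rotIndex, Equiv.image_eq_preimage_symm, Set.mem_preimage, Set.mem_ofPred_eq]
    exact not_congr add_neg_eq_iff_eq_add
  have hsub := rotWeights_image_faceWeights {q : Fin 3 × Fin k | q.1 ≠ m}
  rw [hs] at hsub
  ext p
  constructor
  · rintro ⟨p, ⟨hp, q, hq, hpq⟩, rfl⟩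
    exact ⟨hsub ▸ ⟨p, hp, rfl⟩, rotIndex k q, hs ▸ ⟨q, hq, rfl⟩,
      (rotWeights_apply_rotIndex p q).trans hpq⟩
  · rintro ⟨hp, q, hq, hpq⟩
    rw [← hsub] at hp
    rw [← hs] at hq
    obtain ⟨p, hp, rfl⟩ := hp
    obtain ⟨q, hq, rfl⟩ := hq
    exact ⟨p, ⟨hp, q, hq, (rotWeights_apply_rotIndex p q).symm.trans hpq⟩, rfl⟩

theorem boundaryWeights_subset_blockWeights {k : ℕ} (m : Fin 3) :
    boundaryWeights k m ⊆ blockWeights k := by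
  rintro p ⟨⟨hp, hp1, hps⟩, ⟨l, j⟩, hl, hpq⟩
  have h0 : ∀ j, p (m, j) = 0 := fun j => hps _ (by simp)
  refine ⟨⟨hp, hp1, fun j => ⟨m, h0 j⟩⟩, fun i => ?_⟩
  have key : i = m ∨ i + 1 = m ∨ i = l ∨ i + 1 = l := by
    have hl' : l ≠ m := hl
    clear * - hl'
    revert i l m
    decide
  rcases key with rfl | rfl | rfl | rfl
  · exact ⟨j, Or.inl (h0 j)⟩
  · exact ⟨j, Or.inr (h0 j)⟩
  · exact ⟨j, Or.inl hpq⟩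
  · exact ⟨j, Or.inr hpq⟩

theorem eq_zero_of_bary_eq_zero {k : ℕ} (hk : 2 ≤ k) (m : Fin 3) (p : Fin 3 × Fin k → ℝ)
    (hps : ∀ q ∉ {q : Fin 3 × Fin k | q.1 ≠ m}, p q = 0) (h : bary k p = 0) : p = 0 := by
  have hn := two_mul_sub_one_pos hk
  have hm : ∀ j, p (m, j) = 0 := fun j => hps _ (by simp)
  have hinl : ∀ i, p (0, i) + (2 * ∑ j, p (1, j) - p (1, i)) / (2 * (2 * (k : ℝ) - 1)) = 0 :=
    fun i => (bary_inl p i).symm.trans (congrFun h _)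
  have hinr : ∀ i, p (2, i) + (2 * ∑ j, p (1, j) - p (1, i)) / (2 * (2 * (k : ℝ) - 1)) = 0 :=
    fun i => (bary_inr p i).symm.trans (congrFun h _)
  have hmid : ∀ i, p (1, i) = 0 := by
    by_cases hm1 : m = 1
    · exact fun i => hm1 ▸ hm i
    have hd : ∀ i, p (1, i) = 2 * ∑ j, p (1, j) := fun i => by
      have h0 : (2 * ∑ j, p (1, j) - p (1, i)) / (2 * (2 * (k : ℝ) - 1)) = 0 := by
        fin_cases m
        · simpa [show p (0, i) = 0 from hm i] using hinl i
        · exact absurd rfl hm1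
        · simpa [show p (2, i) = 0 from hm i] using hinr i
      rcases div_eq_zero_iff.1 h0 with h0 | h0 <;> linarith
    have hS : ∑ j, p (1, j) = k * (2 * ∑ j, p (1, j)) := by
      conv_lhs => rw [Finset.sum_congr rfl fun j _ => hd j]
      simp
    have hS0 : ∑ j, p (1, j) = 0 := by
      have : (2 * (2 * (k : ℝ) - 1)) * ∑ j, p (1, j) = 0 := by linarith
      exact (mul_eq_zero.1 this).resolve_left hn.ne'
    intro i
    rw [hd i, hS0, mul_zero]
  ext ⟨l, i⟩
  have hl := hinl i
  have hr := hinr i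
  simp only [hmid, Finset.sum_const_zero, mul_zero, sub_zero, zero_div, add_zero] at hl hr
  fin_cases l
  · exact hl
  · exact hmid i
  · exact hr

theorem intrinsicFrontier_convexHull_vtx {k : ℕ} (hk : 2 ≤ k) (m : Fin 3) :
    intrinsicFrontier ℝ (convexHull ℝ (vtx k '' {q | q.1 ≠ m})) =
      bary k '' boundaryWeights k m :=
  intrinsicFrontier_convexHull_image (eq_zero_of_bary_eq_zero hk m)

theorem exists_homeomorph_omegaB {k : ℕ} (hk : 2 ≤ k) :
    ∃ σ : OmegaB k ≃ₜ OmegaB k, ∀ x : OmegaB k, ∀ p ∈ blockWeights k, bary k p = x →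
      (σ x : V k) = bary k (rotWeights k p) := by
  have hinj := (injOn_bary_discWeights hk).mono (blockWeights_subset_discWeights k)
  have hbij : Set.BijOn (bary k) (blockWeights k) (OmegaB k) := by
    rw [omegaB_eq hk]
    exact hinj.bijOn_image
  have : CompactSpace (blockWeights k) := isCompact_iff_compactSpace.1 (isCompact_blockWeights k)
  let e : blockWeights k ≃ₜ OmegaB k :=
    Continuous.homeoOfEquivCompactToT2 (f := hbij.equiv)
      (((bary k).continuous_of_finiteDimensional.comp continuous_subtype_val).subtype_mk _)
  have hrot : Continuous (rotWeights k) := (rotWeights k).continuous_of_finiteDimensional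
  let ρ : blockWeights k ≃ₜ blockWeights k :=
    { toFun := fun p => ⟨rotWeights k p, rotWeights_mem_blockWeights p.2⟩
      invFun := fun p => ⟨rotWeights k (rotWeights k p),
        rotWeights_mem_blockWeights (rotWeights_mem_blockWeights p.2)⟩
      left_inv := fun p => Subtype.ext (rotWeights_rotWeights_rotWeights _)
      right_inv := fun p => Subtype.ext (rotWeights_rotWeights_rotWeights _)
      continuous_toFun := (hrot.comp continuous_subtype_val).subtype_mk _
      continuous_invFun := (hrot.comp (hrot.comp continuous_subtype_val)).subtype_mk _ }
  refine ⟨e.symm.trans (ρ.trans e), fun x p hp hpx => ?_⟩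
  have hx : e.symm x = ⟨p, hp⟩ := e.symm_apply_eq.2 (Subtype.ext hpx.symm)
  change ((e (ρ (e.symm x)) : OmegaB k) : V k) = _
  rw [hx]
  rfl

theorem affineMap_linearCombination {ι E F : Type*} [Fintype ι] [AddCommGroup E] [Module ℝ E]
    [AddCommGroup F] [Module ℝ F] (f : E →ᵃ[ℝ] F) (v : ι → E) {p : ι → ℝ} (hp : ∑ i, p i = 1) :
    f (Fintype.linearCombination ℝ v p) = ∑ i, p i • f (v i) := by
  have hf : ∀ x, f x = f.linear x + f 0 := fun x => congrFun f.decomp x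
  simp_rw [Fintype.linearCombination_apply, hf (∑ i, p i • v i), hf (v _), smul_add,
    Finset.sum_add_distrib, ← Finset.sum_smul, hp, one_smul, map_sum, map_smul]

theorem bary_rotWeights {k : ℕ} (p : Fin 3 × Fin k → ℝ) :
    bary k (rotWeights k p) = ∑ q, p q • vtx k (rotIndex k q) := by
  rw [Fintype.linearCombination_apply, ← Equiv.sum_comp (rotIndex k)]
  simp only [rotWeights_apply_rotIndex]

theorem image_vtx_preimage {k : ℕ} {S : Set (V k)} (hS : S ⊆ setX k) :
    vtx k '' (vtx k ⁻¹' S) = S := by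
  refine Set.image_preimage_eq_of_subset fun x hx => ?_
  rcases hS hx with (⟨j, rfl⟩ | ⟨j, rfl⟩) | ⟨j, rfl⟩
  · exact ⟨(0, j), rfl⟩
  · exact ⟨(1, j), rfl⟩
  · exact ⟨(2, j), rfl⟩

theorem faceWeights_subset_blockWeights {k : ℕ} {S : Set (V k)} (hS : IsGood k S)
    (hAB : S ≠ setA k ∪ setB k) (hBC : S ≠ setB k ∪ setC k) :
    faceWeights (vtx k ⁻¹' S) ⊆ blockWeights k := by
  obtain ⟨hSX, -, htriple, hAC⟩ := hS
  have htriple' : ∀ j, ∃ i, vtx k (i, j) ∉ S := fun j => by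
    by_contra! h
    refine htriple j ?_
    rintro x (rfl | rfl | rfl)
    · exact h 0
    · exact h 1
    · exact h 2
  have hedge : ∀ m : Fin 3, S ≠ vtx k '' {q | q.1 ≠ m} →
      ∃ j, vtx k (m + 1, j) ∉ S ∨ vtx k (m + 2, j) ∉ S := fun m hm => by
    by_contra! h
    refine hm (Set.Subset.antisymm ?_ ?_)
    · intro x hx
      rw [← image_vtx_preimage hSX] at hx
      obtain ⟨⟨i, j⟩, hij, rfl⟩ := hx
      refine ⟨(i, j), ?_, rfl⟩
      rintro rfl
      obtain ⟨l, hl⟩ := htriple' j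
      have hlm : l = i ∨ l = i + 1 ∨ l = i + 2 := by
        clear * -
        revert l i
        decide
      rcases hlm with rfl | rfl | rfl
      · exact hl hij
      · exact hl (h j).1
      · exact hl (h j).2
    · rintro _ ⟨⟨i, j⟩, hi, rfl⟩
      have him : i = m + 1 ∨ i = m + 2 := by
        have hi' : i ≠ m := hi
        clear * - hi'
        revert i m
        decide
      rcases him with rfl | rfl
      · exact (h j).1
      · exact (h j).2
  rw [setA_union_setB] at hAB
  rw [setB_union_setC] at hBC
  rw [setA_union_setC] at hAC
  rintro p ⟨hp, hp1, hps⟩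
  refine ⟨⟨hp, hp1, fun j => (htriple' j).imp fun i hi => hps _ hi⟩, fun i => ?_⟩
  have himp : ∀ {i j i' j'}, vtx k (i, j) ∉ S ∨ vtx k (i', j') ∉ S →
      p (i, j) = 0 ∨ p (i', j') = 0 := Or.imp (hps _) (hps _)
  fin_cases i
  · exact (hedge 2 hAB).imp fun j => himp
  · exact (hedge 0 hBC).imp fun j => himp
  · exact (hedge 1 hAC).imp fun j => himp

/-- **Block Lemma (symmetry part).** There is a homeomorphism `σ : Ω → Ω` of order 3
which, on each good simplex other than `Δ₁ = ⟨A ∪ B⟩` and `Δ₂ = ⟨B ∪ C⟩`, agrees with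
the unique affine map sending each vertex `v` to `τ v`, where `τ` is the bijection of
`X` given by `A_j ↦ B_j ↦ C_j ↦ A_j`.  In particular `σ` carries the intrinsic boundary
of `Δ₀` onto that of `Δ₁`, that of `Δ₁` onto that of `Δ₂`, and that of `Δ₂` onto that of
`Δ₀`, acting affinely on each of these boundaries. -/
theorem stmt_0 (k : ℕ) (hk : 2 ≤ k) (τ : V k → V k)
    (hτ : ∀ j : Fin k,
      τ (vA k j) = vB k j ∧ τ (vB k j) = vC k j ∧ τ (vC k j) = vA k j) :
    ∃ σ : (OmegaB k) ≃ₜ (OmegaB k),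
      (∀ x, σ (σ (σ x)) = x) ∧
      (∀ S : Set (V k), IsGood k S →
          S ≠ setA k ∪ setB k → S ≠ setB k ∪ setC k →
        (Subtype.val '' (⇑σ '' {x : OmegaB k | (x : V k) ∈ convexHull ℝ S})
            = convexHull ℝ (τ '' S)) ∧
        (∀ F : V k →ᵃ[ℝ] V k, (∀ v ∈ S, F v = τ v) →
          ∀ x : OmegaB k, (x : V k) ∈ convexHull ℝ S → (σ x : V k) = F x)) ∧
      (Subtype.val '' (⇑σ '' {x : OmegaB k | (x : V k) ∈ intrinsicFrontier ℝ (Delta0 k)})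
          = intrinsicFrontier ℝ (Delta1 k)) ∧
      (Subtype.val '' (⇑σ '' {x : OmegaB k | (x : V k) ∈ intrinsicFrontier ℝ (Delta1 k)})
          = intrinsicFrontier ℝ (Delta2 k)) ∧
      (Subtype.val '' (⇑σ '' {x : OmegaB k | (x : V k) ∈ intrinsicFrontier ℝ (Delta2 k)})
          = intrinsicFrontier ℝ (Delta0 k)) ∧
      (∃ F : V k →ᵃ[ℝ] V k, ∀ x : OmegaB k,
          (x : V k) ∈ intrinsicFrontier ℝ (Delta0 k) → (σ x : V k) = F x) ∧
      (∃ F : V k →ᵃ[ℝ] V k, ∀ x : OmegaB k,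
          (x : V k) ∈ intrinsicFrontier ℝ (Delta1 k) → (σ x : V k) = F x) ∧
      (∃ F : V k →ᵃ[ℝ] V k, ∀ x : OmegaB k,
          (x : V k) ∈ intrinsicFrontier ℝ (Delta2 k) → (σ x : V k) = F x) := by
  obtain ⟨σ, hσ⟩ := exists_homeomorph_omegaB hk
  have hmem : ∀ p ∈ blockWeights k, bary k p ∈ OmegaB k := fun p hp => by
    rw [omegaB_eq hk]
    exact ⟨p, hp, rfl⟩
  have himage : ∀ T ⊆ blockWeights k,
      Subtype.val '' (⇑σ '' {x : OmegaB k | (x : V k) ∈ bary k '' T}) =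
        bary k '' (rotWeights k '' T) := fun T hT => by
    ext y
    constructor
    · rintro ⟨_, ⟨x, ⟨p, hp, hpx⟩, rfl⟩, rfl⟩
      exact ⟨_, ⟨p, hp, rfl⟩, (hσ x p (hT hp) hpx).symm⟩
    · rintro ⟨_, ⟨p, hp, rfl⟩, rfl⟩
      exact ⟨_, ⟨⟨bary k p, hmem p (hT hp)⟩, ⟨p, hp, rfl⟩, rfl⟩, hσ _ p (hT hp) rfl⟩
  have hτv : ∀ q, τ (vtx k q) = vtx k (rotIndex k q) := fun ⟨i, j⟩ => by
    fin_cases i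
    · exact (hτ j).1
    · exact (hτ j).2.1
    · exact (hτ j).2.2
  have hfrontier : ∀ m : Fin 3,
      Subtype.val '' (⇑σ '' {x : OmegaB k |
        (x : V k) ∈ intrinsicFrontier ℝ (convexHull ℝ (vtx k '' {q | q.1 ≠ m}))}) =
      intrinsicFrontier ℝ (convexHull ℝ (vtx k '' {q | q.1 ≠ m + 1})) := fun m => by
    simp only [intrinsicFrontier_convexHull_vtx hk]
    rw [himage _ (boundaryWeights_subset_blockWeights m), rotWeights_image_boundaryWeights]
  have haffine : ∀ m : Fin 3, ∃ F : V k →ᵃ[ℝ] V k, ∀ x : OmegaB k,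
      (x : V k) ∈ intrinsicFrontier ℝ (convexHull ℝ (vtx k '' {q | q.1 ≠ m})) →
        (σ x : V k) = F x := fun m => by
    obtain ⟨G, hG⟩ := exists_linearMap_linearCombination_eq (eq_zero_of_bary_eq_zero hk m)
    refine ⟨(bary k ∘ₗ rotWeights k ∘ₗ G).toAffineMap, fun x hx => ?_⟩
    rw [intrinsicFrontier_convexHull_vtx hk] at hx
    obtain ⟨p, hp, hpx⟩ := hx
    rw [hσ x p (boundaryWeights_subset_blockWeights m hp) hpx, ← hpx]
    simp [hG p hp.1.2.2]
  simp only [Delta0, Delta1, Delta2, setA_union_setB, setB_union_setC, setA_union_setC]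
  refine ⟨σ, fun x => ?_, fun S hS hAB hBC => ?_, hfrontier 1, hfrontier 2, hfrontier 0,
    haffine 1, haffine 2, haffine 0⟩
  · obtain ⟨p, hp, hpx⟩ : (x : V k) ∈ bary k '' blockWeights k := omegaB_eq hk ▸ x.2
    have hp' := rotWeights_mem_blockWeights hp
    have h1 := hσ x p hp hpx
    have h2 := hσ (σ x) _ hp' h1.symm
    have h3 := hσ (σ (σ x)) _ (rotWeights_mem_blockWeights hp') h2.symm
    rw [rotWeights_rotWeights_rotWeights, hpx] at h3
    exact Subtype.ext h3
  · rw [← setA_union_setB] at hAB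
    rw [← setB_union_setC] at hBC
    have hblock := faceWeights_subset_blockWeights hS hAB hBC
    have hSv := image_vtx_preimage hS.1
    have hconv : convexHull ℝ S = bary k '' faceWeights (vtx k ⁻¹' S) := by
      rw [← convexHull_image_eq_image_faceWeights, hSv]
    have hτS : τ '' S = vtx k '' (rotIndex k '' (vtx k ⁻¹' S)) := by
      conv_lhs => rw [← hSv]
      simp only [Set.image_image, hτv]
    constructor
    · rw [hconv, himage _ hblock, hτS, convexHull_image_eq_image_faceWeights,
        rotWeights_image_faceWeights]
    · intro F hF x hx
      rw [hconv] at hx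
      obtain ⟨p, hp, hpx⟩ := hx
      rw [hσ x p (hblock hp) hpx, ← hpx, affineMap_linearCombination F _ hp.2.1, bary_rotWeights]
      refine Finset.sum_congr rfl fun q _ => ?_
      by_cases hq : vtx k q ∈ S
      · rw [hF _ hq, hτv]
      · rw [hp.2.2 q hq, zero_smul, zero_smul]
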